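/- arXiv:2403.00737 — 2 statements merged into one kernel-verified Lean document; each statement's English description precedes it below -/
import Mathlib

section
/- There exists a set of 29 points in the plane ℝ² in general position that contains no 6-hole. (Lower-bound half of the main theorem h(6) = 30.) -/
/-- Orientation determinant of three points in the plane:
`det [[1,1,1],[pₓ,qₓ,rₓ],[p_y,q_y,r_y]]`.
The triple `(p,q,r)` is positively oriented iff `det3 p q r > 0`,
and negatively oriented iff `det3 p q r < 0`. -/
noncomputable def det3 (p q r : ℝ × ℝ) : ℝ :=
  Matrix.det !![(1:ℝ), 1, 1; p.1, q.1, r.1; p.2, q.2, r.2]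

/-- A set of points in the plane is in general position if no three
distinct points of it are collinear. -/
def InGenPos (S : Set (ℝ × ℝ)) : Prop :=
  ∀ p ∈ S, ∀ q ∈ S, ∀ r ∈ S, p ≠ q → p ≠ r → q ≠ r →
    ¬ Collinear ℝ ({p, q, r} : Set (ℝ × ℝ))

/-- `P` is a `k`-gon of `S`: a `k`-element subset of `S` in convex position,
i.e. every point of `P` is an extreme point of the convex hull of `P`. -/
def IsGon (k : ℕ) (S P : Set (ℝ × ℝ)) : Prop :=
  P ⊆ S ∧ P.Finite ∧ P.ncard = k ∧
    ∀ p ∈ P, p ∈ Set.extremePoints ℝ (convexHull ℝ P)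

/-- `P` is a `k`-hole of `S`: a `k`-gon of `S` whose convex hull contains
no point of `S` other than the `k` points of `P`. -/
def IsHole (k : ℕ) (S P : Set (ℝ × ℝ)) : Prop :=
  IsGon k S P ∧ ∀ q ∈ S, q ∈ convexHull ℝ P → q ∈ P

/-- x-coordinates and y-coordinates of the 29 points (Overmars). -/
def ovPts : List (ℕ × ℕ) :=
  [(1, 1260),
   (16, 743),
   (22, 531),
   (37, 0),
   (306, 592),
   (310, 531),
   (366, 552),
   (371, 487),
   (374, 525),
   (392, 575),
   (396, 613),
   (410, 539),
   (416, 550),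
   (426, 526),
   (434, 552),
   (436, 535),
   (446, 565),
   (449, 518),
   (450, 498),
   (453, 542),
   (458, 526),
   (489, 537),
   (492, 502),
   (496, 579),
   (516, 467),
   (552, 502),
   (754, 697),
   (777, 194),
   (1259, 320)]

/-- Entry `(a, b)` is a bitmask of indices of points strictly to the left of the line `a → b`. -/
def ovTab : List (List ℕ) :=
  [[0, 536870896, 536870898, 536870902, 536870848, 536870864, 536870400, 536870720, 536870464, 536867840, 536428544, 536868352, 536855552, 536859648, 536412160, 536560640, 534773760, 536429568, 536593408, 534839296, 535363584, 511705088, 530579456, 503316480, 513802240, 469762048, 268435456, 335544320, 0],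
  [12, 0, 536870896, 536870900, 385605121, 402653009, 385613329, 402653041, 402652753, 346096641, 343932929, 385472001, 380192257, 385605137, 379651585, 381244929, 343933953, 385474049, 402390609, 379667969, 380196353, 343999489, 381277697, 335544321, 385613393, 346097153, 1, 402653169, 67108865],
  [8, 9, 0, 536870896, 67109891, 78241363, 75564563, 117440371, 79298163, 67109907, 67108867, 76109395, 75581011, 79289971, 75564627, 78208595, 75499027, 79298419, 117178227, 75585107, 78241395, 76111443, 112983923, 67110419, 117440499, 79429491, 3, 402653171, 134217715],
  [0, 1, 3, 0, 7, 23, 1079, 1911, 1655, 1143, 55, 6135, 2039, 90103, 8183, 98295, 24567, 9043959, 10223607, 131063, 9175031, 10485751, 12582903, 655351, 16777207, 33554423, 67108855, 134217719, 268435447],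
  [46, 151265772, 469761000, 536870880, 0, 536870848, 402652673, 536870721, 536870465, 75564035, 67108871, 385472003, 380192259, 385605121, 346097155, 381244931, 75498499, 385474051, 402390529, 346113539, 380196355, 344000003, 381277699, 67109891, 385613313, 346637827, 7, 402652737, 75564547],
  [14, 134217868, 458629512, 536870848, 15, 0, 1559, 402653009, 79429203, 1047, 23, 75585111, 75564631, 79289939, 75568727, 78208599, 75499095, 79298131, 385613651, 75587159, 78241363, 76111447, 112983891, 67110487, 385875795, 79429459, 1623, 402653137, 117178195],
  [446, 151257516, 461306280, 536869760, 134218158, 536869256, 0, 536870656, 536870400, 1079, 63, 381277715, 75580947, 385605139, 75564563, 78206483, 75499031, 385474067, 402390545, 75585043, 380229139, 76109331, 381279763, 67110423, 385613329, 346674707, 1559, 402652673, 78239251],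
  [62, 134217740, 419430408, 536868864, 46, 134217742, 63, 0, 127, 1407, 383, 6007, 1911, 8511351, 73591, 89975, 8055, 79298423, 79429495, 8519543, 76152695, 77201271, 79691639, 122743, 117440371, 83885943, 9043831, 402653009, 134217587],
  [190, 134217900, 457572488, 536868992, 174, 457441420, 191, 536870400, 0, 1151, 127, 75585143, 1655, 78241399, 67180151, 76111479, 5751, 79298163, 385613395, 75587191, 78249591, 76144247, 112983635, 67196535, 385875539, 79429203, 71287, 402652753, 117177939],
  [2558, 190773756, 469760488, 536869248, 461306348, 536869320, 536869256, 536868864, 536868992, 0, 511, 536867840, 536593409, 536859649, 380175361, 402211841, 75498515, 536462337, 536597505, 379651073, 384386049, 343999491, 380191745, 67109907, 385434625, 346096641, 1047, 402244609, 75564035],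
  [441342, 192936956, 469761016, 536869824, 469761000, 536869832, 536869760, 536869376, 536869504, 536868864, 0, 536866816, 536862720, 536854528, 536412161, 536559616, 379584513, 536428544, 536592384, 534839297, 535363585, 377487361, 513867777, 335544323, 518062081, 343932929, 23, 379650049, 67108867],
  [510, 151396860, 460759464, 536862720, 151396844, 461283720, 155591084, 536862728, 461283464, 511, 1023, 0, 2047, 402380289, 71543, 78206547, 6007, 385472001, 536606209, 75585111, 380229203, 76109395, 381277715, 87927, 385603073, 346674771, 8476535, 402388481, 78239315],
  [11262, 156674556, 461285800, 536864768, 156674540, 461302152, 461285804, 536864776, 536864904, 272894, 3071, 536862720, 0, 536855552, 75564631, 385435137, 1655, 402245121, 536593409, 77678099, 380192257, 75580947, 381240833, 67176055, 385467905, 346637843, 67191, 402376193, 78202387],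
  [3070, 151257580, 457572744, 536772608, 151257582, 457572748, 151257516, 528351240, 458621064, 2558, 7167, 134480382, 3071, 0, 8191, 90103, 24575, 381279827, 536598017, 8511351, 78241399, 76144503, 381410899, 122871, 385605121, 79289939, 9035639, 402380289, 112844371],
  [442366, 157202940, 461289896, 536846336, 190757356, 461285768, 461289900, 536780808, 469674120, 156678654, 441342, 536780936, 461285800, 536838144, 0, 536805376, 8183, 536412160, 536543232, 379651585, 535364609, 75564563, 380175361, 67180151, 384369665, 346097155, 71543, 401146881, 77661715],
  [277502, 155593212, 458629544, 536739840, 155593196, 458629512, 458631596, 536748040, 460726408, 134625790, 277503, 458629548, 151398910, 536739848, 16383, 0, 32767, 536429569, 536559616, 75587447, 380196371, 76111479, 381244929, 89975, 385435137, 346641939, 8478583, 402211841, 78206483],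
  [2031614, 192871420, 461306344, 536780800, 461306860, 461306248, 461306280, 536797192, 536799368, 461306348, 157219838, 536797320, 536799624, 536772608, 536780808, 536739840, 0, 536346624, 536477696, 535822336, 534773760, 377488385, 513802241, 67110519, 517996545, 343933953, 1655, 379584513, 75498499],
  [310270, 151265788, 457441416, 527695872, 151265772, 457441676, 151265708, 457441288, 457441420, 276990, 310271, 151265790, 134490622, 155451820, 311295, 277502, 327679, 0, 536346624, 131071, 9043959, 77201399, 381279827, 655359, 385472001, 79298131, 10092535, 402245121, 112852563],
  [15358, 134218156, 419430536, 526385152, 134218222, 150995084, 134218158, 457179144, 150995116, 10750, 15359, 510, 11262, 2558, 49151, 16383, 65535, 131071, 0, 262143, 786431, 10223607, 79429495, 1835007, 385613395, 83623799, 12320759, 402390529, 117178227],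
  [1507326, 156678652, 460761512, 536215552, 190233068, 460759432, 460761516, 527826952, 460759176, 156695038, 1506302, 460759464, 458664428, 527827080, 156678654, 460726408, 458751, 536084480, 535822336, 0, 534839296, 75585043, 379651073, 131063, 518063105, 346113539, 8511351, 383845377, 77678099],
  [458750, 155625980, 457580936, 526647296, 155625964, 457580940, 155593132, 459669512, 457572488, 151435774, 457726, 155591084, 155625982, 457572744, 441342, 155593196, 983039, 526647304, 534773760, 458751, 0, 76152695, 380192257, 786431, 384386049, 78241363, 9043959, 401163265, 111795795],
  [23068670, 190774268, 458662312, 524288000, 190773740, 458662280, 458664364, 457572360, 458629256, 190773756, 157285374, 458662316, 459188716, 458621064, 459192812, 458629512, 157219838, 457441288, 524288008, 458664428, 457572488, 0, 528482304, 2097151, 511705088, 343999489, 10223607, 377487361, 75564563],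
  [2097150, 151398908, 419692680, 520093696, 151398892, 419692684, 151396780, 452984840, 419692716, 152484350, 18807806, 151396844, 151431678, 151257516, 152484862, 151398910, 18808830, 151265708, 452984968, 152501246, 151435774, 2097151, 0, 4194303, 513802241, 79429495, 12582903, 379651073, 112983635],
  [25165822, 192937980, 461371880, 527826944, 461372396, 461371784, 461371816, 528359432, 461285512, 461371884, 192936956, 528392328, 461302152, 528351240, 461285768, 528359560, 461306248, 527695872, 526385152, 527826952, 526647296, 524288000, 520093696, 0, 503316480, 469762049, 87927, 335544321, 67109891],
  [6291454, 134480300, 402653192, 503316480, 134480366, 134217868, 134480302, 402653196, 134217900, 134658558, 2030590, 134488574, 134621694, 134480382, 135707646, 134625790, 2031614, 134490622, 134218156, 1506302, 134659070, 6291455, 2097150, 8388607, 0, 16777207, 50331639, 384369665, 117440371],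
  [33554430, 157219324, 423886984, 469762048, 156678636, 423886988, 156641708, 419430408, 423887020, 157219326, 159382526, 156639660, 156674540, 424018348, 157202940, 156641772, 159316990, 423887276, 419430536, 156678652, 424026540, 157219838, 419692680, 25165822, 469762056, 0, 16777207, 343932929, 78241363],
  [201326590, 469762044, 469762040, 402653184, 469762024, 469760392, 469760424, 460718088, 469690504, 469760488, 469761000, 461283464, 469690760, 460718216, 469674120, 461250696, 469694856, 459538440, 457179144, 460726408, 459669512, 457441288, 452984840, 461285512, 402653192, 419430408, 0, 268435456, 1],
  [67108862, 12, 8, 268435456, 430, 14, 446, 46, 174, 408062, 23002110, 262654, 272894, 264702, 1489918, 408574, 23003134, 276990, 510, 18283518, 441342, 23068670, 18807806, 58720254, 1506302, 25165822, 67108863, 0, 134217719],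
  [268435454, 201326588, 134217736, 0, 192870892, 151257228, 190196140, 134217740, 151257260, 192870908, 201325564, 190194092, 190228972, 155582892, 190757356, 190196204, 192871420, 155451820, 150995084, 190233068, 155591084, 190773740, 151257516, 192936956, 134217868, 156639660, 201326590, 8, 0]]

def ovX (i : ℕ) : ℕ := (ovPts.getD i (0, 0)).1
def ovY (i : ℕ) : ℕ := (ovPts.getD i (0, 0)).2
def ovO (a b : ℕ) : ℕ := (ovTab.getD a []).getD b 0

/-- Triangle test: no point is strictly inside (either orientation). -/
def ovOk (a b c : ℕ) : Bool :=
  Nat.beq (Nat.land (Nat.land (ovO a b) (ovO b c)) (ovO c a)) 0 &&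
  Nat.beq (Nat.land (Nat.land (ovO b a) (ovO c b)) (ovO a c)) 0

def ovAll (f : ℕ → Bool) : Bool := Nat.rec true (fun n r => f n && r) 29

theorem ovAll_spec {f : ℕ → Bool} (h : ovAll f = true) (i : ℕ) (hi : i < 29) : f i = true := by
  have key : ∀ n : ℕ, (Nat.rec true (fun n r => f n && r) n : Bool) = true →
      ∀ i < n, f i = true := by
    intro n
    induction n with
    | zero => intro _ i hi; omega
    | succ k ih =>
      intro h i hi
      have h' : (f k && (Nat.rec true (fun n r => f n && r) k : Bool)) = true := h
      rw [Bool.and_eq_true] at h'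
      rcases Nat.lt_succ_iff_lt_or_eq.mp hi with h1 | h1
      · exact ih h'.2 i h1
      · rw [h1]; exact h'.1
  exact key 29 h i hi

def ovImp (a b : Bool) : Bool := Bool.rec true b a

theorem ovImp_spec {a b : Bool} (h : ovImp a b = true) (ha : a = true) : b = true := by
  subst ha; exact h

def ovPos (a b q : ℕ) : Bool :=
  Nat.blt (ovX b * ovY a + ovX a * ovY q + ovY b * ovX q)
    (ovX b * ovY q + ovY b * ovX a + ovY a * ovX q)

def ovCheckTab : Bool :=
  ovAll fun a => ovAll fun b => ovAll fun q => ovImp (Nat.testBit (ovO a b) q) (ovPos a b q)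

/-- The masks only contain points with index below 29. -/
def ovCheckBound : Bool :=
  ovAll fun a => ovAll fun b => Nat.blt (ovO a b) (2 ^ 29)

def ovCheckGen : Bool :=
  ovAll fun a => ovAll fun b => ovImp (Nat.blt a b) <| ovAll fun c => ovImp (Nat.blt b c) <|
    (Nat.testBit (ovO a b) c || Nat.testBit (ovO b a) c)

def ovCheckHole : Bool :=
  ovAll fun a => ovAll fun b => ovImp (Nat.blt a b) <|
  ovAll fun c => ovImp (Nat.blt b c && ovOk a b c) <|
  ovAll fun d => ovImp (Nat.blt c d && (ovOk a b d && (ovOk a c d && ovOk b c d))) <|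
  ovAll fun e => ovImp (Nat.blt d e && (ovOk a b e && (ovOk a c e && (ovOk b c e &&
    (ovOk a d e && (ovOk b d e && ovOk c d e)))))) <|
  ovAll fun f => !(Nat.blt e f && (ovOk a b f && (ovOk a c f && (ovOk b c f &&
    (ovOk a d f && (ovOk b d f && (ovOk c d f && (ovOk a e f && (ovOk b e f &&
    (ovOk c e f && ovOk d e f))))))))))

theorem ovCheckTab_true : ovCheckTab = true := by decide +kernel
theorem ovCheckBound_true : ovCheckBound = true := by decide +kernel
theorem ovCheckGen_true : ovCheckGen = true := by decide +kernel
theorem ovCheckHole_true : ovCheckHole = true := by decide +kernel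

def ovCheckInj : Bool :=
  ovAll fun a => ovAll fun b => ovImp (Nat.blt a b) (Nat.blt (ovX a) (ovX b))

theorem ovCheckInj_true : ovCheckInj = true := by decide +kernel

noncomputable def ovPt (i : ℕ) : ℝ × ℝ := ((ovX i : ℝ), (ovY i : ℝ))

theorem ovX_lt {a b : ℕ} (hb : b < 29) (hab : a < b) : ovX a < ovX b := by
  have h := ovImp_spec (ovAll_spec (ovAll_spec ovCheckInj_true a (hab.trans hb)) b hb)
    (by simpa using hab)
  simpa using h

theorem ovPt_inj : Set.InjOn ovPt (Set.Iio 29) := by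
  intro a ha b hb h
  have hx : ovX a = ovX b := by
    have := congrArg Prod.fst h
    simpa [ovPt] using this
  rcases lt_trichotomy a b with h1 | h1 | h1
  · have := ovX_lt hb h1; omega
  · exact h1
  · have := ovX_lt ha h1; omega

/-- Explicit orientation determinant. -/
def ovD (p q r : ℝ × ℝ) : ℝ := (q.1 - p.1) * (r.2 - p.2) - (q.2 - p.2) * (r.1 - p.1)

theorem ovTab_spec {a b q : ℕ} (ha : a < 29) (hb : b < 29) (hq : q < 29)
    (h : Nat.testBit (ovO a b) q = true) : 0 < ovD (ovPt a) (ovPt b) (ovPt q) := by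
  have h1 := ovImp_spec (ovAll_spec (ovAll_spec (ovAll_spec ovCheckTab_true a ha) b hb) q hq) h
  have h2 : ovX b * ovY a + ovX a * ovY q + ovY b * ovX q <
      ovX b * ovY q + ovY b * ovX a + ovY a * ovX q := by simpa [ovPos] using h1
  have h3 : ((ovX b * ovY a + ovX a * ovY q + ovY b * ovX q : ℕ) : ℝ) <
      ((ovX b * ovY q + ovY b * ovX a + ovY a * ovX q : ℕ) : ℝ) := by exact_mod_cast h2
  push_cast at h3
  simp only [ovD, ovPt]
  nlinarith

theorem ovO_bound {a b q : ℕ} (ha : a < 29) (hb : b < 29)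
    (h : Nat.testBit (ovO a b) q = true) : q < 29 := by
  have h1 := ovAll_spec (ovAll_spec ovCheckBound_true a ha) b hb
  have h2 : ovO a b < 2 ^ 29 := by simpa only [Nat.blt_eq] using h1
  by_contra hq
  have h3 : ovO a b < 2 ^ q := h2.trans_le (Nat.pow_le_pow_right (by norm_num) (by omega))
  rw [Nat.testBit_lt_two_pow h3] at h
  cases h

theorem ovMask {a b c : ℕ} (ha : a < 29) (hb : b < 29) (hc : c < 29)
    (h : Nat.land (Nat.land (ovO a b) (ovO b c)) (ovO c a) ≠ 0) :
    ∃ q < 29, 0 < ovD (ovPt a) (ovPt b) (ovPt q) ∧ 0 < ovD (ovPt b) (ovPt c) (ovPt q) ∧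
      0 < ovD (ovPt c) (ovPt a) (ovPt q) := by
  obtain ⟨q, hq⟩ := Nat.exists_testBit_of_ne_zero h
  have hq' : (((ovO a b) &&& (ovO b c)) &&& (ovO c a)).testBit q = true := hq
  rw [Nat.testBit_and, Nat.testBit_and, Bool.and_eq_true, Bool.and_eq_true] at hq'
  have hb' := ovO_bound ha hb hq'.1.1
  exact ⟨q, hb', ovTab_spec ha hb hb' hq'.1.1, ovTab_spec hb hc hb' hq'.1.2,
    ovTab_spec hc ha hb' hq'.2⟩

theorem ovInside {a b c q : ℝ × ℝ} {P : Set (ℝ × ℝ)} (ha : a ∈ P) (hb : b ∈ P) (hc : c ∈ P)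
    (h1 : 0 < ovD a b q) (h2 : 0 < ovD b c q) (h3 : 0 < ovD c a q) :
    q ∈ convexHull ℝ P ∧ q ∉ Set.extremePoints ℝ (convexHull ℝ P) := by
  have ha' := subset_convexHull ℝ P ha
  have hb' := subset_convexHull ℝ P hb
  have hc' := subset_convexHull ℝ P hc
  have hconv := convex_convexHull ℝ P
  obtain ⟨α, hα⟩ : ∃ α, α = ovD b c q := ⟨_, rfl⟩
  obtain ⟨β, hβ⟩ : ∃ β, β = ovD c a q := ⟨_, rfl⟩
  obtain ⟨γ, hγ⟩ : ∃ γ, γ = ovD a b q := ⟨_, rfl⟩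
  have e1 : (α + β + γ) * q.1 = α * a.1 + β * b.1 + γ * c.1 := by
    rw [hα, hβ, hγ]; simp only [ovD]; ring
  have e2 : (α + β + γ) * q.2 = α * a.2 + β * b.2 + γ * c.2 := by
    rw [hα, hβ, hγ]; simp only [ovD]; ring
  rw [← hγ] at h1
  rw [← hα] at h2
  rw [← hβ] at h3
  have hs : 0 < α + β + γ := by linarith
  have ht : 0 < β + γ := by linarith
  have hm : (β / (β + γ)) • b + (γ / (β + γ)) • c ∈ convexHull ℝ P :=
    hconv hb' hc' (by positivity) (by positivity) (by field_simp)
  have hq : q ∈ openSegment ℝ a ((β / (β + γ)) • b + (γ / (β + γ)) • c) := by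
    refine ⟨α / (α + β + γ), (β + γ) / (α + β + γ), by positivity, by positivity,
      by field_simp; ring, ?_⟩
    ext
    · simp only [Prod.fst_add, Prod.smul_fst, smul_eq_mul]
      field_simp
      linarith
    · simp only [Prod.snd_add, Prod.smul_snd, smul_eq_mul]
      field_simp
      linarith
  refine ⟨hconv.openSegment_subset ha' hm hq, fun hex => ?_⟩
  have := hex.2 ha' hm hq
  subst this
  rw [hγ] at h1
  simp [ovD] at h1

def ovS : Set (ℝ × ℝ) := ovPt '' Set.Iio 29

theorem ovOk_of_hole {P : Set (ℝ × ℝ)} (hP : IsHole 6 ovS P) {a b c : ℕ}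
    (ha : a < 29) (hb : b < 29) (hc : c < 29)
    (pa : ovPt a ∈ P) (pb : ovPt b ∈ P) (pc : ovPt c ∈ P) : ovOk a b c = true := by
  have key : ∀ {a b c : ℕ}, a < 29 → b < 29 → c < 29 → ovPt a ∈ P → ovPt b ∈ P → ovPt c ∈ P →
      Nat.land (Nat.land (ovO a b) (ovO b c)) (ovO c a) = 0 := by
    intro a b c ha hb hc pa pb pc
    by_contra h
    obtain ⟨q, hq, h1, h2, h3⟩ := ovMask ha hb hc h
    obtain ⟨hi, hn⟩ := ovInside pa pb pc h1 h2 h3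
    exact hn (hP.1.2.2.2 _ (hP.2 _ ⟨q, hq, rfl⟩ hi))
  have k1 := key ha hb hc pa pb pc
  have k2 : Nat.land (Nat.land (ovO b a) (ovO c b)) (ovO a c) = 0 := by
    have := key hb ha hc pb pa pc
    have e : (ovO b a &&& ovO a c) &&& ovO c b = 0 := this
    have e' : (ovO b a &&& ovO c b) &&& ovO a c = 0 := by
      rw [Nat.land_assoc, Nat.land_comm (ovO c b), ← Nat.land_assoc]; exact e
    exact e'
  unfold ovOk
  rw [k1, k2]
  rfl

theorem ovNoHole (P : Set (ℝ × ℝ)) (hP : IsHole 6 ovS P) : False := by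
  classical
  obtain ⟨hsub, hfin, hcard, -⟩ := hP.1
  let T : Finset ℕ := (Finset.range 29).filter fun i => ovPt i ∈ P
  have hT : ∀ i, i ∈ T ↔ i < 29 ∧ ovPt i ∈ P := by intro i; simp [T]
  have himg : ovPt '' (T : Set ℕ) = P := by
    ext p
    constructor
    · rintro ⟨i, hi, rfl⟩
      exact ((hT i).1 hi).2
    · intro hp
      obtain ⟨i, hi, rfl⟩ := hsub hp
      exact ⟨i, (hT i).2 ⟨hi, hp⟩, rfl⟩
  have hTc : T.card = 6 := by
    rw [← hcard, ← himg, Set.InjOn.ncard_image, Set.ncard_coe_finset]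
    exact ovPt_inj.mono fun i hi => ((hT i).1 hi).1
  let g := T.orderEmbOfFin hTc
  have hg : ∀ i, g i < 29 ∧ ovPt (g i) ∈ P := fun i => (hT _).1 (T.orderEmbOfFin_mem hTc i)
  have hlt : ∀ i j : Fin 6, i < j → Nat.blt (g i) (g j) = true := by
    intro i j hij
    rw [Nat.blt_eq]
    exact g.strictMono hij
  have hok : ∀ i j k, ovOk (g i) (g j) (g k) = true := fun i j k =>
    ovOk_of_hole hP (hg i).1 (hg j).1 (hg k).1 (hg i).2 (hg j).2 (hg k).2
  have l01 := hlt 0 1 (by decide)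
  have l12 := hlt 1 2 (by decide)
  have l23 := hlt 2 3 (by decide)
  have l34 := hlt 3 4 (by decide)
  have l45 := hlt 4 5 (by decide)
  have s1 := ovImp_spec (ovAll_spec (ovAll_spec ovCheckHole_true _ (hg 0).1) _ (hg 1).1) l01
  have s2 := ovImp_spec (ovAll_spec s1 _ (hg 2).1) (by simp only [l12, hok, Bool.and_self])
  have s3 := ovImp_spec (ovAll_spec s2 _ (hg 3).1) (by simp only [l23, hok, Bool.and_self])
  have s4 := ovImp_spec (ovAll_spec s3 _ (hg 4).1) (by simp only [l34, hok, Bool.and_self])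
  have s5 := ovAll_spec s4 _ (hg 5).1
  simp only [l45, hok, Bool.and_self, Bool.not_true] at s5
  cases s5

theorem ovD_collinear {p q r : ℝ × ℝ} (h : Collinear ℝ ({p, q, r} : Set (ℝ × ℝ))) :
    ovD p q r = 0 := by
  obtain ⟨v, hv⟩ := (collinear_iff_of_mem (p₀ := p) (by simp)).1 h
  obtain ⟨s, hs⟩ := hv q (by simp)
  obtain ⟨t, ht⟩ := hv r (by simp)
  rw [hs, ht]
  simp [ovD]
  ring

theorem ovD_ne {a b c : ℕ} (hc : c < 29) (hab : a < b) (hbc : b < c) :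
    ovD (ovPt a) (ovPt b) (ovPt c) ≠ 0 := by
  have hb := hbc.trans hc
  have ha := hab.trans hb
  have h1 := ovImp_spec (ovAll_spec (ovAll_spec ovCheckGen_true a ha) b hb) (by simpa using hab)
  have h2 := ovImp_spec (ovAll_spec h1 c hc) (by simpa using hbc)
  rw [Bool.or_eq_true] at h2
  rcases h2 with h | h
  · exact (ovTab_spec ha hb hc h).ne'
  · have := ovTab_spec hb ha hc h
    intro h0
    simp only [ovD] at this h0
    nlinarith

theorem ovD_ne' {a b c : ℕ} (ha : a < 29) (hb : b < 29) (hc : c < 29) (hab : a ≠ b) (hac : a ≠ c)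
    (hbc : b ≠ c) : ovD (ovPt a) (ovPt b) (ovPt c) ≠ 0 := by
  have r1 : ∀ p q r, ovD p q r = ovD q r p := by intro p q r; simp only [ovD]; ring
  have r2 : ∀ p q r, ovD p q r = - ovD q p r := by intro p q r; simp only [ovD]; ring
  rcases lt_or_gt_of_ne hab with h1 | h1 <;> rcases lt_or_gt_of_ne hac with h2 | h2 <;>
    rcases lt_or_gt_of_ne hbc with h3 | h3
  · exact ovD_ne hc h1 h3
  · rw [r1, r2, r1, r1, neg_ne_zero, r1]; first | exact ovD_ne hb h2 h3 | (rw [r1]; first | exact ovD_ne hb h2 h3 | (rw [r1]; exact ovD_ne hb h2 h3))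
  · omega
  · rw [r1, r1]; exact ovD_ne hb h2 h1
  · rw [r2, neg_ne_zero]; exact ovD_ne hc h1 h2
  · omega
  · rw [r1]; exact ovD_ne ha h3 h2
  · rw [r2, neg_ne_zero, r1, r1]; exact ovD_ne ha h3 h1

theorem ovGenPos : InGenPos ovS := by
  rintro _ ⟨a, ha, rfl⟩ _ ⟨b, hb, rfl⟩ _ ⟨c, hc, rfl⟩ hab hac hbc hcol
  exact ovD_ne' ha hb hc (fun h => hab (h ▸ rfl)) (fun h => hac (h ▸ rfl))
    (fun h => hbc (h ▸ rfl)) (ovD_collinear hcol)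

/-- There exists a set of 29 points in the plane in general position
containing no 6-hole. -/
theorem exists_29_point_set_without_6hole :
    ∃ S : Set (ℝ × ℝ), S.Finite ∧ S.ncard = 29 ∧ InGenPos S ∧
      ¬ ∃ P : Set (ℝ × ℝ), IsHole 6 S P := by
  refine ⟨ovS, (Set.finite_Iio 29).image _, ?_, ovGenPos, fun ⟨P, hP⟩ => ovNoHole P hP⟩
  rw [ovS, Set.InjOn.ncard_image ovPt_inj, ← Finset.coe_Iio, Set.ncard_coe_finset]
  simp
end

section
/- Let a, b, c, d ∈ ℝ² be points with strictly increasing x-coordinates (the x-coordinate of a is less than that of b, which is less than that of c, which is less than that of d). If the triples (a, b, c) and (b, c, d) are both positively oriented, then the triple (a, c, d) is positively oriented; and if (a, b, c) and (b, c, d) are both negatively oriented, then (a, c, d) is negatively oriented. (Signotope axiom, second form.) -/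
/-- Signotope axiom, second form. -/
theorem signotope_axiom_second_form (a b c d : ℝ × ℝ)
    (hab : a.1 < b.1) (hbc : b.1 < c.1) (hcd : c.1 < d.1) :
    (det3 a b c > 0 → det3 b c d > 0 → det3 a c d > 0) ∧
    (det3 a b c < 0 → det3 b c d < 0 → det3 a c d < 0) := by
  have key : (c.1 - b.1) * det3 a c d
      = (c.1 - a.1) * det3 b c d + (d.1 - c.1) * det3 a b c := by
    simp [det3, Matrix.det_fin_three]
    ring
  have h1 : 0 < c.1 - b.1 := by linarith
  have h2 : 0 < c.1 - a.1 := by linarith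
  have h3 : 0 < d.1 - c.1 := by linarith
  constructor
  · intro h h'
    have p := mul_pos h2 h'
    have q := mul_pos h3 h
    exact pos_of_mul_pos_right (by rw [key]; linarith) h1.le
  · intro h h'
    have p := mul_neg_of_pos_of_neg h2 h'
    have q := mul_neg_of_pos_of_neg h3 h
    by_contra hn
    have r := mul_nonneg h1.le (not_lt.mp hn)
    linarith
end
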